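/- Let d ≥ 0 be an integer and let G be a bipartite graph with parts A and B, each of size n. Then β_d(G) ≥ ⌊(1/2)·∑_{v ∈ A ∪ B} min(1, (d+1)/(d(v)+1))⌋, where d(v) denotes the degree of vertex v in G. -/

import Mathlib

open Finset

/-- `degenBiholeNumber d G A B` is `β_d(G)`: the largest `k` such that there are `S ⊆ A`,
`T ⊆ B` with `|S| = |T| = k` and the subgraph of `G` induced on `S ∪ T` is `d`-degenerate,
i.e. every nonempty subset `s` of `S ∪ T` contains a vertex of degree at most `d` in the
subgraph induced on `s`. -/
noncomputable def degenBiholeNumber {V : Type*} [DecidableEq V] (d : ℕ)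
    (G : SimpleGraph V) [DecidableRel G.Adj] (A B : Finset V) : ℕ :=
  sSup {k | ∃ S T : Finset V, S ⊆ A ∧ T ⊆ B ∧ S.card = k ∧ T.card = k ∧
    ∀ s : Finset V, s ⊆ S ∪ T → s.Nonempty →
      ∃ v ∈ s, (s.filter (fun u => G.Adj v u)).card ≤ d}

/-- the weight of a vertex of degree `k` -/
noncomputable def cwF (d k : ℕ) : ℝ := min 1 (((d : ℝ) + 1) / (k + 1))

lemma cwF_le_one (d k : ℕ) : cwF d k ≤ 1 := min_le_left _ _

lemma cwF_pos (d k : ℕ) : 0 < cwF d k := by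
  unfold cwF
  exact lt_min one_pos (by positivity)

lemma cwF_anti (d : ℕ) {k l : ℕ} (h : k ≤ l) : cwF d l ≤ cwF d k := by
  unfold cwF
  apply min_le_min le_rfl
  have : (k : ℝ) ≤ l := by exact_mod_cast h
  gcongr

lemma cwF_eq (d k : ℕ) (h : d ≤ k) : cwF d k = ((d : ℝ) + 1) / (k + 1) := by
  unfold cwF
  apply min_eq_right
  have : (d : ℝ) ≤ k := by exact_mod_cast h
  rw [div_le_one (by positivity)]
  linarith

/-- the gain -/
noncomputable def cwG (d k : ℕ) : ℝ := ((d : ℝ) + 1) / (k * (k + 1))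

lemma cwF_succ (d k : ℕ) (h : d ≤ k) : cwF d k = cwF d (k + 1) + cwG d (k + 1) := by
  rw [cwF_eq d k h, cwF_eq d (k + 1) (by omega), cwG]
  push_cast
  field_simp

lemma cwG_anti (d : ℕ) {k l : ℕ} (hk : 0 < k) (h : k ≤ l) : cwG d l ≤ cwG d k := by
  unfold cwG
  have : (k : ℝ) ≤ l := by exact_mod_cast h
  have : (0 : ℝ) < k := by exact_mod_cast hk
  gcongr

lemma cw_arith (d x y : ℕ) (hx : d < x) (hy : d < y) :
    cwF d x + cwF d y ≤ y * cwG d x + x * cwG d y := by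
  rw [cwF_eq d x hx.le, cwF_eq d y hy.le, cwG, cwG]
  have hx0 : (0 : ℝ) < x := by exact_mod_cast (by omega : 0 < x)
  have hy0 : (0 : ℝ) < y := by exact_mod_cast (by omega : 0 < y)
  have key : (y * (((d : ℝ) + 1) / (x * (x + 1))) + x * (((d : ℝ) + 1) / (y * (y + 1))))
      - (((d : ℝ) + 1) / (x + 1) + ((d : ℝ) + 1) / (y + 1))
      = ((d : ℝ) + 1) * ((x - y) ^ 2 * (x + y + 1)) / (x * (x + 1) * (y * (y + 1))) := by
    field_simp
    ring
  have : 0 ≤ ((d : ℝ) + 1) * ((x - y) ^ 2 * (x + y + 1)) / (x * (x + 1) * (y * (y + 1))) := by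
    positivity
  linarith

lemma cw_side {α : Type*} [DecidableEq α] (d x : ℕ) (A N : Finset α) (a : α) (ha : a ∈ A)
    (deg deg' : α → ℕ) (hN : N ⊆ A.erase a)
    (h1 : ∀ v ∈ N, deg v = deg' v + 1 ∧ d < deg v ∧ deg v ≤ x)
    (h2 : ∀ v ∈ A.erase a, deg' v ≤ deg v) :
    ∑ v ∈ A, cwF d (deg v) - cwF d (deg a) + N.card * cwG d x
      ≤ ∑ v ∈ A.erase a, cwF d (deg' v) := by
  rw [← Finset.add_sum_erase A (fun v => cwF d (deg v)) ha]
  have e : (N.card : ℝ) * cwG d x = ∑ v ∈ A.erase a, if v ∈ N then cwG d x else 0 := by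
    rw [← Finset.sum_filter, Finset.filter_mem_eq_inter, Finset.inter_eq_right.2 hN]
    simp
  rw [e, add_sub_cancel_left, ← Finset.sum_add_distrib]
  apply Finset.sum_le_sum
  intro v hv
  split_ifs with h
  · obtain ⟨q1, q2, q3⟩ := h1 v h
    have := cwF_succ d (deg' v) (by omega)
    rw [← q1] at this
    have := cwG_anti d (by omega) q3
    linarith
  · have := cwF_anti d (h2 v hv)
    linarith

/-- bipartite degeneracy -/
def cwDeg {V : Type*} [DecidableEq V] (d : ℕ) (E : Finset (V × V)) (S T : Finset V) : Prop :=
  ∀ s t : Finset V, s ⊆ S → t ⊆ T → (s.Nonempty ∨ t.Nonempty) →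
    (∃ a ∈ s, (t.filter (fun b => (a, b) ∈ E)).card ≤ d) ∨
    (∃ b ∈ t, (s.filter (fun a => (a, b) ∈ E)).card ≤ d)

lemma cw_erase_card {V : Type*} [DecidableEq V] (p : V → Prop) [DecidablePred p]
    (B : Finset V) (b : V) (hb : b ∈ B) :
    (B.filter p).card = ((B.erase b).filter p).card + if p b then 1 else 0 := by
  rw [Finset.filter_erase]
  split_ifs with h
  · rw [Finset.card_erase_add_one]
    simp [hb, h]
  · rw [Finset.erase_eq_of_notMem]
    · rfl
    · simp [h]

set_option maxHeartbeats 2000000 in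
lemma cw_main {V : Type*} [DecidableEq V] (d : ℕ) : ∀ (m : ℕ) (A B : Finset V)
    (E : Finset (V × V)) (x y : ℕ), A.card + E.card + x + y ≤ m →
    d ≤ x → d ≤ y →
    (∀ a ∈ A, (B.filter (fun b => (a, b) ∈ E)).card ≤ x) →
    (∀ b ∈ B, (A.filter (fun a => (a, b) ∈ E)).card ≤ y) →
    A.card = B.card →
    ∃ S T : Finset V, S ⊆ A ∧ T ⊆ B ∧ S.card = T.card ∧ cwDeg d E S T ∧
      ∑ a ∈ A, cwF d (B.filter (fun b => (a, b) ∈ E)).card +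
      ∑ b ∈ B, cwF d (A.filter (fun a => (a, b) ∈ E)).card + cwF d x + cwF d y - 2
        ≤ 2 * S.card := by
  intro m
  induction m with
  | zero =>
    intro A B E x y hm hx hy hA hB hc
    have hA0 : A = ∅ := Finset.card_eq_zero.1 (by omega)
    have hB0 : B = ∅ := Finset.card_eq_zero.1 (by omega)
    subst hA0 hB0
    refine ⟨∅, ∅, by simp, by simp, rfl, ?_, ?_⟩
    · intro s t hs ht h
      simp_all
    · have := cwF_le_one d x
      have := cwF_le_one d y
      simp
      linarith
  | succ m ih =>
    intro A B E x y hm hx hy hA hB hc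
    -- trivial case
    have triv : cwDeg d E A B → ∃ S T : Finset V, S ⊆ A ∧ T ⊆ B ∧ S.card = T.card ∧ cwDeg d E S T ∧
      ∑ a ∈ A, cwF d (B.filter (fun b => (a, b) ∈ E)).card +
      ∑ b ∈ B, cwF d (A.filter (fun a => (a, b) ∈ E)).card + cwF d x + cwF d y - 2
        ≤ 2 * S.card := by
      intro h
      refine ⟨A, B, Finset.Subset.refl _, Finset.Subset.refl _, hc, h, ?_⟩
      have h1 := Finset.sum_le_card_nsmul A
        (fun a => cwF d (B.filter (fun b => (a, b) ∈ E)).card) 1 (fun a _ => cwF_le_one _ _)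
      have h2 := Finset.sum_le_card_nsmul B
        (fun b => cwF d (A.filter (fun a => (a, b) ∈ E)).card) 1 (fun a _ => cwF_le_one _ _)
      rw [← hc] at h2
      simp only [nsmul_eq_mul, mul_one] at h1 h2
      have := cwF_le_one d x
      have := cwF_le_one d y
      linarith
    rcases Nat.eq_or_lt_of_le hx with hxd | hxd
    · apply triv
      intro s t hs ht hne
      by_cases hs0 : s.Nonempty
      · obtain ⟨a, ha⟩ := hs0
        refine Or.inl ⟨a, ha, ?_⟩
        have := hA a (hs ha)
        have := Finset.card_le_card (Finset.filter_subset_filter (fun b => (a, b) ∈ E) ht)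
        omega
      · obtain ⟨b, hb⟩ := hne.resolve_left hs0
        refine Or.inr ⟨b, hb, ?_⟩
        rw [Finset.not_nonempty_iff_eq_empty.1 hs0]
        simp
    rcases Nat.eq_or_lt_of_le hy with hyd | hyd
    · apply triv
      intro s t hs ht hne
      by_cases ht0 : t.Nonempty
      · obtain ⟨b, hb⟩ := ht0
        refine Or.inr ⟨b, hb, ?_⟩
        have := hB b (ht hb)
        have := Finset.card_le_card (Finset.filter_subset_filter (fun a => (a, b) ∈ E) hs)
        omega
      · obtain ⟨a, ha⟩ := hne.resolve_right ht0
        refine Or.inl ⟨a, ha, ?_⟩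
        rw [Finset.not_nonempty_iff_eq_empty.1 ht0]
        simp
    by_cases hAx : ∀ a ∈ A, (B.filter (fun b => (a, b) ∈ E)).card ≤ x - 1
    · obtain ⟨S, T, h1, h2, h3, h4, h5⟩ := ih A B E (x - 1) y (by omega) (by omega) hy hAx hB hc
      refine ⟨S, T, h1, h2, h3, h4, ?_⟩
      have := cwF_anti d (Nat.sub_le x 1)
      linarith
    by_cases hBy : ∀ b ∈ B, (A.filter (fun a => (a, b) ∈ E)).card ≤ y - 1
    · obtain ⟨S, T, h1, h2, h3, h4, h5⟩ := ih A B E x (y - 1) (by omega) hx (by omega) hA hBy hc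
      refine ⟨S, T, h1, h2, h3, h4, ?_⟩
      have := cwF_anti d (Nat.sub_le y 1)
      linarith
    -- removing edges
    have remove : ∀ E' : Finset (V × V), E' ⊆ E → E'.card < E.card →
        (∀ S T : Finset V, S ⊆ A → T ⊆ B → cwDeg d E' S T → cwDeg d E S T) →
        ∃ S T : Finset V, S ⊆ A ∧ T ⊆ B ∧ S.card = T.card ∧ cwDeg d E S T ∧
      ∑ a ∈ A, cwF d (B.filter (fun b => (a, b) ∈ E)).card +
      ∑ b ∈ B, cwF d (A.filter (fun a => (a, b) ∈ E)).card + cwF d x + cwF d y - 2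
        ≤ 2 * S.card := by
      intro E' hE' hcard hdeg
      have l1 : ∀ a, (B.filter (fun b => (a, b) ∈ E')).card
          ≤ (B.filter (fun b => (a, b) ∈ E)).card := fun a =>
        Finset.card_le_card (Finset.monotone_filter_right _ (fun b _ hb => hE' hb))
      have l2 : ∀ b, (A.filter (fun a => (a, b) ∈ E')).card
          ≤ (A.filter (fun a => (a, b) ∈ E)).card := fun b =>
        Finset.card_le_card (Finset.monotone_filter_right _ (fun a _ ha => hE' ha))
      obtain ⟨S, T, h1, h2, h3, h4, h5⟩ := ih A B E' x y (by omega) hx hy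
        (fun a ha => (l1 a).trans (hA a ha)) (fun b hb => (l2 b).trans (hB b hb)) hc
      refine ⟨S, T, h1, h2, h3, hdeg S T h1 h2 h4, ?_⟩
      have s1 := Finset.sum_le_sum (s := A) (fun a _ => cwF_anti d (l1 a))
      have s2 := Finset.sum_le_sum (s := B) (fun b _ => cwF_anti d (l2 b))
      linarith
    by_cases hlowA : ∃ u ∈ A, 0 < (B.filter (fun b => (u, b) ∈ E)).card ∧
        (B.filter (fun b => (u, b) ∈ E)).card ≤ d
    · obtain ⟨u, hu, hu0, hud⟩ := hlowA
      apply remove (E.filter (fun e => e.1 ≠ u)) (Finset.filter_subset _ _)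
      · obtain ⟨b, hb⟩ := Finset.card_pos.1 hu0
        apply Finset.card_lt_card
        rw [Finset.filter_ssubset]
        exact ⟨(u, b), (Finset.mem_filter.1 hb).2, by simp⟩
      · intro S T hS hT h s t hs ht hne
        by_cases hus : u ∈ s
        · refine Or.inl ⟨u, hus, le_trans (Finset.card_le_card ?_) hud⟩
          exact Finset.filter_subset_filter _ (ht.trans hT)
        · rcases h s t hs ht hne with ⟨a, ha, h'⟩ | ⟨b, hb, h'⟩
          · refine Or.inl ⟨a, ha, le_trans (Finset.card_le_card ?_) h'⟩
            intro b hb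
            have : a ≠ u := fun h => hus (h ▸ ha)
            simp_all
          · refine Or.inr ⟨b, hb, le_trans (Finset.card_le_card ?_) h'⟩
            intro a ha
            have : a ≠ u := fun h => hus (h ▸ (Finset.mem_filter.1 ha).1)
            simp_all
    by_cases hlowB : ∃ u ∈ B, 0 < (A.filter (fun a => (a, u) ∈ E)).card ∧
        (A.filter (fun a => (a, u) ∈ E)).card ≤ d
    · obtain ⟨u, hu, hu0, hud⟩ := hlowB
      apply remove (E.filter (fun e => e.2 ≠ u)) (Finset.filter_subset _ _)
      · obtain ⟨b, hb⟩ := Finset.card_pos.1 hu0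
        apply Finset.card_lt_card
        rw [Finset.filter_ssubset]
        exact ⟨(b, u), (Finset.mem_filter.1 hb).2, by simp⟩
      · intro S T hS hT h s t hs ht hne
        by_cases hus : u ∈ t
        · refine Or.inr ⟨u, hus, le_trans (Finset.card_le_card ?_) hud⟩
          exact Finset.filter_subset_filter _ (hs.trans hS)
        · rcases h s t hs ht hne with ⟨a, ha, h'⟩ | ⟨b, hb, h'⟩
          · refine Or.inl ⟨a, ha, le_trans (Finset.card_le_card ?_) h'⟩
            intro b hb
            have : b ≠ u := fun h => hus (h ▸ (Finset.mem_filter.1 hb).1)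
            simp_all
          · refine Or.inr ⟨b, hb, le_trans (Finset.card_le_card ?_) h'⟩
            intro a ha
            have : b ≠ u := fun h => hus (h ▸ hb)
            simp_all
    have hhA : ∀ u ∈ A, ∀ b ∈ B, (u, b) ∈ E → d < (B.filter (fun b => (u, b) ∈ E)).card := by
      intro u hu b hb hub
      by_contra hcon
      exact hlowA ⟨u, hu, Finset.card_pos.2 ⟨b, by simp [hb, hub]⟩, by omega⟩
    have hhB : ∀ u ∈ B, ∀ a ∈ A, (a, u) ∈ E → d < (A.filter (fun a => (a, u) ∈ E)).card := by
      intro u hu b hb hub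
      by_contra hcon
      exact hlowB ⟨u, hu, Finset.card_pos.2 ⟨b, by simp [hb, hub]⟩, by omega⟩
    -- deletion of a pair
    have sums : ∀ a ∈ A, ∀ b ∈ B, (B.filter (fun b => (a, b) ∈ E)).card = x →
        (A.filter (fun a => (a, b) ∈ E)).card = y →
        ∑ a ∈ A, cwF d (B.filter (fun b => (a, b) ∈ E)).card +
        ∑ b ∈ B, cwF d (A.filter (fun a => (a, b) ∈ E)).card
        - (if (a, b) ∈ E then cwG d x + cwG d y else 0) ≤
        ∑ v ∈ A.erase a, cwF d ((B.erase b).filter (fun b => (v, b) ∈ E)).card +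
        ∑ w ∈ B.erase b, cwF d ((A.erase a).filter (fun a => (a, w) ∈ E)).card := by
      intro a ha b hb hax hby
      have c1 := cw_erase_card (fun v => (v, b) ∈ E) A a ha
      have c2 := cw_erase_card (fun w => (a, w) ∈ E) B b hb
      have s1 := cw_side d x A ((A.erase a).filter (fun v => (v, b) ∈ E)) a ha
        (fun v => (B.filter (fun b => (v, b) ∈ E)).card)
        (fun v => ((B.erase b).filter (fun b => (v, b) ∈ E)).card)
        (Finset.filter_subset _ _)
        (by
          intro v hv
          obtain ⟨hv1, hv2⟩ := Finset.mem_filter.1 hv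
          have hvA := Finset.mem_of_mem_erase hv1
          have := cw_erase_card (fun w => (v, w) ∈ E) B b hb
          rw [if_pos hv2] at this
          exact ⟨this, hhA v hvA b hb hv2, hA v hvA⟩)
        (by
          intro v hv
          exact Finset.card_le_card (Finset.filter_subset_filter _ (Finset.erase_subset _ _)))
      have s2 := cw_side d y B ((B.erase b).filter (fun w => (a, w) ∈ E)) b hb
        (fun w => (A.filter (fun a => (a, w) ∈ E)).card)
        (fun w => ((A.erase a).filter (fun a => (a, w) ∈ E)).card)
        (Finset.filter_subset _ _)
        (by
          intro v hv
          obtain ⟨hv1, hv2⟩ := Finset.mem_filter.1 hv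
          have hvA := Finset.mem_of_mem_erase hv1
          have := cw_erase_card (fun w => (w, v) ∈ E) A a ha
          rw [if_pos hv2] at this
          exact ⟨this, hhB v hvA a ha hv2, hB v hvA⟩)
        (by
          intro v hv
          exact Finset.card_le_card (Finset.filter_subset_filter _ (Finset.erase_subset _ _)))
      have ar := cw_arith d x y hxd hyd
      rw [hby] at c1
      rw [hax] at c2
      simp only [hax] at s1
      simp only [hby] at s2
      have c1' : (y : ℝ) = _ := congrArg (Nat.cast : ℕ → ℝ) c1
      have c2' : (x : ℝ) = _ := congrArg (Nat.cast : ℕ → ℝ) c2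
      push_cast at c1' c2'
      have e1 : (y : ℝ) * cwG d x = _ := congrArg (fun z : ℝ => z * cwG d x) c1'
      have e2 : (x : ℝ) * cwG d y = _ := congrArg (fun z : ℝ => z * cwG d y) c2'
      simp only [add_mul] at e1 e2
      split_ifs at e1 e2 ⊢ <;> linarith
    -- finishing step
    have finish : ∀ a ∈ A, ∀ b ∈ B, ∀ x' y' : ℕ, x' ≤ x → y' ≤ y → d ≤ x' → d ≤ y' →
        (∀ v ∈ A.erase a, ((B.erase b).filter (fun b => (v, b) ∈ E)).card ≤ x') →
        (∀ w ∈ B.erase b, ((A.erase a).filter (fun a => (a, w) ∈ E)).card ≤ y') →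
        (∑ a ∈ A, cwF d (B.filter (fun b => (a, b) ∈ E)).card +
          ∑ b ∈ B, cwF d (A.filter (fun a => (a, b) ∈ E)).card + cwF d x + cwF d y ≤
        ∑ v ∈ A.erase a, cwF d ((B.erase b).filter (fun b => (v, b) ∈ E)).card +
        ∑ w ∈ B.erase b, cwF d ((A.erase a).filter (fun a => (a, w) ∈ E)).card
          + cwF d x' + cwF d y') →
        ∃ S T : Finset V, S ⊆ A ∧ T ⊆ B ∧ S.card = T.card ∧ cwDeg d E S T ∧
      ∑ a ∈ A, cwF d (B.filter (fun b => (a, b) ∈ E)).card +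
      ∑ b ∈ B, cwF d (A.filter (fun a => (a, b) ∈ E)).card + cwF d x + cwF d y - 2
        ≤ 2 * S.card := by
      intro a ha b hb x' y' hx' hy' hdx hdy q1 q2 q3
      have k1 := Finset.card_erase_add_one ha
      have k2 := Finset.card_erase_add_one hb
      obtain ⟨S, T, h1, h2, h3, h4, h5⟩ := ih (A.erase a) (B.erase b) E x' y' (by omega)
        hdx hdy q1 q2 (by omega)
      exact ⟨S, T, h1.trans (Finset.erase_subset _ _), h2.trans (Finset.erase_subset _ _), h3, h4,
        by linarith⟩
    have mA : ∀ a b v : V, ((B.erase b).filter (fun b => (v, b) ∈ E)).card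
        ≤ (B.filter (fun b => (v, b) ∈ E)).card := fun a b v =>
      Finset.card_le_card (Finset.filter_subset_filter _ (Finset.erase_subset _ _))
    have mB : ∀ a w : V, ((A.erase a).filter (fun a => (a, w) ∈ E)).card
        ≤ (A.filter (fun a => (a, w) ∈ E)).card := fun a w =>
      Finset.card_le_card (Finset.filter_subset_filter _ (Finset.erase_subset _ _))
    by_cases hnon : ∃ a ∈ A, ∃ b ∈ B, (B.filter (fun b => (a, b) ∈ E)).card = x ∧
        (A.filter (fun a => (a, b) ∈ E)).card = y ∧ (a, b) ∉ E
    · obtain ⟨a, ha, b, hb, hax, hby, hab⟩ := hnon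
      have s := sums a ha b hb hax hby
      rw [if_neg hab] at s
      exact finish a ha b hb x y le_rfl le_rfl hx hy
        (fun v hv => (mA a b v).trans (hA v (Finset.mem_of_mem_erase hv)))
        (fun w hw => (mB a w).trans (hB w (Finset.mem_of_mem_erase hw))) (by linarith)
    · push Not at hAx hBy hnon
      obtain ⟨a, ha, hax⟩ := hAx
      obtain ⟨b, hb, hby⟩ := hBy
      have hax : (B.filter (fun b => (a, b) ∈ E)).card = x := by
        have := hA a ha
        omega
      have hby : (A.filter (fun a => (a, b) ∈ E)).card = y := by
        have := hB b hb
        omega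
      have s := sums a ha b hb hax hby
      rw [if_pos (hnon a ha b hb hax hby)] at s
      have fx := cwF_succ d (x - 1) (by omega)
      have fy := cwF_succ d (y - 1) (by omega)
      rw [Nat.sub_add_cancel (by omega)] at fx fy
      refine finish a ha b hb (x - 1) (y - 1) (by omega) (by omega) (by omega) (by omega)
        ?_ ?_ (by linarith)
      · intro v hv
        have hvA := Finset.mem_of_mem_erase hv
        have h1 := hA v hvA
        have h2 := mA a b v
        by_cases hvx : (B.filter (fun b => (v, b) ∈ E)).card = x
        · have := cw_erase_card (fun w => (v, w) ∈ E) B b hb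
          rw [if_pos (hnon v hvA b hb hvx hby)] at this
          omega
        · omega
      · intro w hw
        have hwB := Finset.mem_of_mem_erase hw
        have h1 := hB w hwB
        have h2 := mB a w
        by_cases hwy : (A.filter (fun a => (a, w) ∈ E)).card = y
        · have := cw_erase_card (fun v => (v, w) ∈ E) A a ha
          rw [if_pos (hnon a ha w hwB hax hwy)] at this
          omega
        · omega

/-- For an integer `d ≥ 0` and an `n × n` bipartite graph `G` with parts `A`
and `B`, `β_d(G) ≥ ⌊(1/2) · ∑_{v ∈ A ∪ B} min(1, (d+1)/(d(v)+1))⌋`. -/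
theorem degen_bihole_caro_wei {V : Type*} [Fintype V] [DecidableEq V] (d : ℕ)
    (G : SimpleGraph V) [DecidableRel G.Adj] (n : ℕ) (A B : Finset V)
    (hdisj : Disjoint A B) (hcover : A ∪ B = Finset.univ)
    (hbip : ∀ u v, G.Adj u v → (u ∈ A ∧ v ∈ B) ∨ (u ∈ B ∧ v ∈ A))
    (hA : A.card = n) (hB : B.card = n) :
    ⌊(1 / 2 : ℝ) * ∑ v ∈ A ∪ B, min 1 (((d : ℝ) + 1) / (G.degree v + 1))⌋
      ≤ (degenBiholeNumber d G A B : ℤ) := by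
  have hAB : ∀ v, v ∈ A → v ∉ B := fun v h1 h2 => Finset.disjoint_left.1 hdisj h1 h2
  have nbA : ∀ u v, u ∈ A → G.Adj u v → v ∈ B := by
    intro u v hu h
    rcases hbip u v h with h | h
    · exact h.2
    · exact absurd h.1 (hAB u hu)
  have nbB : ∀ u v, u ∈ B → G.Adj u v → v ∈ A := by
    intro u v hu h
    rcases hbip u v h with h | h
    · exact absurd hu (hAB u h.1)
    · exact h.2
  set E : Finset (V × V) := Finset.univ.filter (fun e => G.Adj e.1 e.2) with hE
  have memE : ∀ a b, (a, b) ∈ E ↔ G.Adj a b := by simp [hE]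
  have dA : ∀ a ∈ A, (B.filter (fun b => (a, b) ∈ E)).card = G.degree a := by
    intro a ha
    rw [← SimpleGraph.card_neighborFinset_eq_degree]
    congr 1
    ext b
    simp only [Finset.mem_filter, memE, SimpleGraph.mem_neighborFinset]
    exact ⟨fun h => h.2, fun h => ⟨nbA a b ha h, h⟩⟩
  have dB : ∀ b ∈ B, (A.filter (fun a => (a, b) ∈ E)).card = G.degree b := by
    intro b hb
    rw [← SimpleGraph.card_neighborFinset_eq_degree]
    congr 1
    ext a
    simp only [Finset.mem_filter, memE, SimpleGraph.mem_neighborFinset]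
    exact ⟨fun h => h.2.symm, fun h => ⟨nbB b a hb h, h.symm⟩⟩
  obtain ⟨S, T, hS, hT, hST, hdeg, hsum⟩ := cw_main d _ A B E (d + n) (d + n) le_rfl
    (by omega) (by omega)
    (fun a _ => (Finset.card_filter_le _ _).trans (by omega))
    (fun a _ => (Finset.card_filter_le _ _).trans (by omega)) (by omega)
  rw [Finset.sum_congr rfl (fun a ha => by rw [dA a ha]),
    Finset.sum_congr (s₁ := B) rfl (fun b hb => by rw [dB b hb]),
    ← Finset.sum_union hdisj] at hsum
  have hpos := cwF_pos d (d + n)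
  have hk : S.card ≤ degenBiholeNumber d G A B := by
    unfold degenBiholeNumber
    apply le_csSup
    · refine ⟨n, ?_⟩
      rintro k ⟨S', T', hS', -, h, -⟩
      rw [← h, ← hA]
      exact Finset.card_le_card hS'
    · refine ⟨S, T, hS, hT, rfl, hST.symm, ?_⟩
      intro s hs hne
      have hne' : (s.filter (· ∈ S)).Nonempty ∨ (s.filter (· ∈ T)).Nonempty := by
        obtain ⟨v, hv⟩ := hne
        rcases Finset.mem_union.1 (hs hv) with h | h
        · exact Or.inl ⟨v, by simp [hv, h]⟩
        · exact Or.inr ⟨v, by simp [hv, h]⟩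
      rcases hdeg (s.filter (· ∈ S)) (s.filter (· ∈ T)) (fun v hv => (Finset.mem_filter.1 hv).2)
        (fun v hv => (Finset.mem_filter.1 hv).2) hne' with ⟨a, ha, h⟩ | ⟨b, hb, h⟩
      · obtain ⟨ha1, ha2⟩ := Finset.mem_filter.1 ha
        refine ⟨a, ha1, le_trans (Finset.card_le_card ?_) h⟩
        intro u hu
        obtain ⟨hu1, hu2⟩ := Finset.mem_filter.1 hu
        have huB := nbA a u (hS ha2) hu2
        have huT : u ∈ T := (Finset.mem_union.1 (hs hu1)).resolve_left
          (fun h => hAB u (hS h) huB)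
        simp only [Finset.mem_filter, memE]
        exact ⟨⟨hu1, huT⟩, hu2⟩
      · obtain ⟨hb1, hb2⟩ := Finset.mem_filter.1 hb
        refine ⟨b, hb1, le_trans (Finset.card_le_card ?_) h⟩
        intro u hu
        obtain ⟨hu1, hu2⟩ := Finset.mem_filter.1 hu
        have huA := nbB b u (hT hb2) hu2
        have huS : u ∈ S := (Finset.mem_union.1 (hs hu1)).resolve_right
          (fun h => hAB u huA (hT h))
        simp only [Finset.mem_filter, memE]
        exact ⟨⟨hu1, huS⟩, hu2.symm⟩
  have hfl : ⌊(1 / 2 : ℝ) * ∑ v ∈ A ∪ B, min 1 (((d : ℝ) + 1) / (G.degree v + 1))⌋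
      < (S.card : ℤ) + 1 := by
    rw [Int.floor_lt]
    simp only [cwF] at hsum hpos
    push_cast at hsum hpos ⊢
    linarith
  omega
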